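/- arXiv:2509.17915 — 6 statements merged into one kernel-verified Lean document; each statement's English description precedes it below -/
import Mathlib

section
/- There exists a constant C > 0 such that for every t > 0 and every s ∈ ℝ, setting g = a_t · k₀ · h_s ∈ SL(3,ℝ), the eigenvalues of the symmetric positive definite matrix g·gᵀ satisfy |(1/2)·log λ₁(g gᵀ) − (t + |s|)| ≤ C, |(1/2)·log λ₂(g gᵀ) − t| ≤ C, and |(1/2)·log λ₃(g gᵀ) + (2t + |s|)| ≤ C. (Equivalently, the Cartan projection μ(a_t k₀ h_s) lies in diag(t+|s|, t, −2t−|s|) + C₀ for a fixed compact set C₀.) -/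
open Matrix Real Filter

noncomputable section

/-- `a_t = diag(e^t, e^{-2t}, e^t)` -/
def aMat (t : ℝ) : Matrix (Fin 3) (Fin 3) ℝ :=
  Matrix.diagonal ![Real.exp t, Real.exp (-2 * t), Real.exp t]

/-- `h_t = diag(e^t, 1, e^{-t})` -/
def hMat (t : ℝ) : Matrix (Fin 3) (Fin 3) ℝ :=
  Matrix.diagonal ![Real.exp t, 1, Real.exp (-t)]

/-- the fixed rotation `k₀` -/
def k0Mat : Matrix (Fin 3) (Fin 3) ℝ :=
  !![1/2, 1/Real.sqrt 2, 1/2;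
     -(1/Real.sqrt 2), 0, 1/Real.sqrt 2;
     1/2, -(1/Real.sqrt 2), 1/2]

/-- The characteristic polynomial of a `3 × 3` matrix in terms of its entries, evaluated at `y`. -/
theorem eval_charpoly_fin_three (G : Matrix (Fin 3) (Fin 3) ℝ) (y : ℝ) :
    G.charpoly.eval y =
      y ^ 3 - (G 0 0 + G 1 1 + G 2 2) * y ^ 2 +
        ((G 0 0 * G 1 1 - G 0 1 * G 1 0) + (G 0 0 * G 2 2 - G 0 2 * G 2 0) +
          (G 1 1 * G 2 2 - G 1 2 * G 2 1)) * y - G.det := by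
  rw [Matrix.eval_charpoly, Matrix.det_fin_three, Matrix.det_fin_three]
  simp
  ring

/-- The entries of `g gᵀ` for `g = a_t k₀ h_s`. -/
theorem aMat_mul_k0Mat_mul_hMat_mul_transpose (t s : ℝ) :
    aMat t * k0Mat * hMat s * (aMat t * k0Mat * hMat s)ᵀ =
      let a := exp t
      let b := exp (-2 * t)
      let P := exp s ^ 2
      let Q := exp (-s) ^ 2
      let r := 1 / √2
      !![a ^ 2 * (P + Q + 2) / 4, a * b * r * (Q - P) / 2, a ^ 2 * (P + Q - 2) / 4;
         a * b * r * (Q - P) / 2, b ^ 2 * (P + Q) / 2, a * b * r * (Q - P) / 2;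
         a ^ 2 * (P + Q - 2) / 4, a * b * r * (Q - P) / 2, a ^ 2 * (P + Q + 2) / 4] := by
  have hr : (1 / √2) ^ 2 = (1 / 2 : ℝ) := by rw [div_pow, Real.sq_sqrt (by norm_num)]; norm_num
  simp only [aMat, k0Mat, hMat]
  generalize 1 / √2 = r at hr ⊢
  ext i j
  fin_cases i <;> fin_cases j <;>
    simp [Matrix.mul_apply, Fin.sum_univ_three, Matrix.diagonal_apply] <;> grind

/-- Vieta's formulas for the characteristic polynomial of `g gᵀ`, `g = a_t k₀ h_s`. -/
theorem esymm_eigenvalues_aMat_mul_k0Mat_mul_hMat {t s l1 l2 l3 : ℝ}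
    (h : (aMat t * k0Mat * hMat s * (aMat t * k0Mat * hMat s)ᵀ).charpoly =
      (Polynomial.X - Polynomial.C l1) * (Polynomial.X - Polynomial.C l2) *
        (Polynomial.X - Polynomial.C l3)) :
    l1 + l2 + l3 = exp t ^ 2 * (exp s ^ 2 + exp (-s) ^ 2 + 2) / 2 +
        exp (-2 * t) ^ 2 * (exp s ^ 2 + exp (-s) ^ 2) / 2 ∧
      l1 * l2 + l1 * l3 + l2 * l3 =
        exp t ^ 2 * exp (-2 * t) ^ 2 * (exp s ^ 2 + exp (-s) ^ 2 + 2) / 2 +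
        exp t ^ 4 * (exp s ^ 2 + exp (-s) ^ 2) / 2 ∧
      l1 * l2 * l3 = 1 := by
  have heval (y : ℝ) := congrArg (Polynomial.eval y) h
  have hab : exp t ^ 2 * exp (-2 * t) = 1 := by
    rw [← Real.exp_nat_mul, ← Real.exp_add]; simp
  have hpq : exp s * exp (-s) = 1 := by rw [← Real.exp_add]; simp
  have hr : (1 / √2) ^ 2 = (1 / 2 : ℝ) := by rw [div_pow, Real.sq_sqrt (by norm_num)]; norm_num
  rw [aMat_mul_k0Mat_mul_hMat_mul_transpose] at heval
  simp only [eval_charpoly_fin_three, Matrix.det_fin_three, Polynomial.eval_mul,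
    Polynomial.eval_sub, Polynomial.eval_X, Polynomial.eval_C] at heval
  simp only [Matrix.of_apply, Matrix.cons_val] at heval
  clear h
  generalize exp t = a at *
  generalize exp (-2 * t) = b at *
  generalize exp s = p at *
  generalize exp (-s) = q at *
  generalize 1 / √2 = r at *
  have key (y : ℝ) :
      y ^ 3 - (a ^ 2 * (p ^ 2 + q ^ 2 + 2) / 2 + b ^ 2 * (p ^ 2 + q ^ 2) / 2) * y ^ 2 +
      (a ^ 2 * b ^ 2 * (p ^ 2 + q ^ 2 + 2) / 2 + a ^ 4 * (p ^ 2 + q ^ 2) / 2) * y - 1 =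
      (y - l1) * (y - l2) * (y - l3) := by
    rw [← heval y]
    clear heval
    grind
  have h0 := key 0
  have h1 := key 1
  have h2 := key (-1)
  refine ⟨?_, ?_, ?_⟩ <;> linarith

/-- Size of ordered positive reals whose elementary symmetric functions are comparable to
`exp (u + v)`, `exp (2 * u + v)` and `1`. -/
theorem abs_log_sub_le_of_esymm {l1 l2 l3 u v : ℝ} (h3 : 0 < l3) (h32 : l3 ≤ l2) (h21 : l2 ≤ l1)
    (e1l : exp (u + v) / 2 ≤ l1 + l2 + l3) (e1u : l1 + l2 + l3 ≤ 3 * exp (u + v))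
    (e2l : exp (2 * u + v) / 2 ≤ l1 * l2 + l1 * l3 + l2 * l3)
    (e2u : l1 * l2 + l1 * l3 + l2 * l3 ≤ 3 * exp (2 * u + v)) (e3 : l1 * l2 * l3 = 1) :
    |log l1 - (u + v)| ≤ log 6 ∧ |log l2 - u| ≤ 2 * log 6 ∧ |log l3 + (2 * u + v)| ≤ log 6 := by
  have hl2 : 0 < l2 := h3.trans_le h32
  have hl1 : 0 < l1 := hl2.trans_le h21
  have key {x w : ℝ} (hx : 0 < x) (hl : exp w ≤ 6 * x) (hu : x ≤ 6 * exp w) :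
      |log x - w| ≤ log 6 := by
    have h1 := Real.log_le_log (Real.exp_pos w) hl
    have h2 := Real.log_le_log hx hu
    rw [Real.log_mul (by norm_num) hx.ne', Real.log_exp] at h1
    rw [Real.log_mul (by norm_num) (Real.exp_ne_zero w), Real.log_exp] at h2
    rw [abs_le]
    constructor <;> linarith
  have p12 : 0 < l1 * l2 := mul_pos hl1 hl2
  have i13 : l1 * l3 ≤ l1 * l2 := by gcongr
  have i23 : l2 * l3 ≤ l1 * l2 := by rw [mul_comm l1]; gcongr; exact h32.trans h21
  have k1 := key (w := u + v) hl1 (by linarith) (by linarith [Real.exp_pos (u + v)])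
  have k12 := key (w := 2 * u + v) p12 (by linarith)
    (by nlinarith [Real.exp_pos (2 * u + v), mul_pos hl1 h3, mul_pos hl2 h3])
  have hlog := congrArg Real.log e3
  rw [Real.log_mul p12.ne' h3.ne', Real.log_one] at hlog
  rw [Real.log_mul hl1.ne' hl2.ne'] at hlog k12
  rw [abs_le] at k1 k12
  refine ⟨abs_le.2 k1, ?_, ?_⟩ <;> rw [abs_le] <;> constructor <;> linarith

/-- the Cartan projection of `a_t k₀ h_s` is `diag(t+|s|, t, -2t-|s|)`
up to a uniformly bounded error: if `λ₁ ≥ λ₂ ≥ λ₃ > 0` are the eigenvalues (with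
multiplicity, encoded via the characteristic polynomial) of `g gᵀ`, for
`g = a_t k₀ h_s`, then `(1/2) log λᵢ` is within a uniform constant of `t+|s|`, `t`,
`-2t-|s|` respectively. -/
theorem cartan_projection_estimate :
    ∃ Cb : ℝ, 0 < Cb ∧ ∀ t s : ℝ, 0 < t →
      ∀ l1 l2 l3 : ℝ, 0 < l3 → l3 ≤ l2 → l2 ≤ l1 →
        (aMat t * k0Mat * hMat s * (aMat t * k0Mat * hMat s)ᵀ).charpoly =
          (Polynomial.X - Polynomial.C l1) * (Polynomial.X - Polynomial.C l2) *
            (Polynomial.X - Polynomial.C l3) →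
        |(1/2) * Real.log l1 - (t + |s|)| ≤ Cb ∧
        |(1/2) * Real.log l2 - t| ≤ Cb ∧
        |(1/2) * Real.log l3 + (2 * t + |s|)| ≤ Cb := by
  refine ⟨Real.log 6, Real.log_pos (by norm_num), fun t s ht l1 l2 l3 h3 h32 h21 h => ?_⟩
  obtain ⟨e1, e2, e3⟩ := esymm_eigenvalues_aMat_mul_k0Mat_mul_hMat h
  have hsum : exp (2 * |s|) ≤ exp s ^ 2 + exp (-s) ^ 2 ∧
      exp s ^ 2 + exp (-s) ^ 2 ≤ 2 * exp (2 * |s|) := by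
    simp only [← Real.exp_nat_mul]
    have hs : exp (2 * s) ≤ exp (2 * |s|) := by gcongr; exact le_abs_self s
    have hs' : exp (2 * -s) ≤ exp (2 * |s|) := by gcongr; exact neg_le_abs s
    push_cast
    refine ⟨?_, by linarith⟩
    rcases abs_cases s with ⟨h, -⟩ | ⟨h, -⟩ <;> rw [h] <;>
      linarith [Real.exp_pos (2 * s), Real.exp_pos (2 * -s)]
  have hM : 1 ≤ exp (2 * |s|) := Real.one_le_exp (by positivity)
  have ha : 1 ≤ exp t := Real.one_le_exp ht.le
  have hb : exp (-2 * t) ≤ 1 := Real.exp_le_one_iff.2 (by linarith)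
  have hb0 : 0 < exp (-2 * t) := Real.exp_pos _
  have hE1 : exp (2 * t + 2 * |s|) = exp t ^ 2 * exp (2 * |s|) := by
    rw [← Real.exp_nat_mul, ← Real.exp_add]; simp
  have hE2 : exp (2 * (2 * t) + 2 * |s|) = exp t ^ 4 * exp (2 * |s|) := by
    rw [← Real.exp_nat_mul, ← Real.exp_add]; push_cast; ring_nf
  obtain ⟨hl, hu⟩ := hsum
  have ha2 : 1 ≤ exp t ^ 2 := one_le_pow₀ ha
  have hb2 : exp (-2 * t) ^ 2 ≤ 1 := pow_le_one₀ hb0.le hb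
  have ha4 : exp t ^ 2 * exp (-2 * t) ^ 2 ≤ exp t ^ 4 := by nlinarith
  generalize exp s ^ 2 + exp (-s) ^ 2 = S at *
  have hp : 0 < exp t ^ 2 * exp (-2 * t) ^ 2 := by positivity
  have hd : 0 < exp (-2 * t) ^ 2 := by positivity
  have bounds {x : ℝ} (hx : 0 ≤ x) :
      x * exp (2 * |s|) / 2 ≤ x * S / 2 ∧ x * S / 2 ≤ x * exp (2 * |s|) ∧
        x * S / 2 ≤ x * (S + 2) / 2 ∧ x * (S + 2) / 2 ≤ 2 * (x * exp (2 * |s|)) := by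
    refine ⟨?_, ?_, ?_, ?_⟩ <;> nlinarith
  have hx4 : 0 < exp t ^ 4 := by positivity
  have mono {x y : ℝ} (h : x ≤ y) : x * exp (2 * |s|) ≤ y * exp (2 * |s|) := by gcongr
  obtain ⟨x1, x2, x3, x4⟩ := bounds (zero_le_one.trans ha2)
  obtain ⟨d1, d2, d3, d4⟩ := bounds hd.le
  obtain ⟨c1, c2, c3, c4⟩ := bounds hp.le
  obtain ⟨z1, z2, z3, z4⟩ := bounds hx4.le
  have hdx := mono (hb2.trans ha2)
  have hcz := mono ha4
  have hd0 : 0 < exp (-2 * t) ^ 2 * exp (2 * |s|) := by positivity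
  have hc0 : 0 < exp t ^ 2 * exp (-2 * t) ^ 2 * exp (2 * |s|) := by positivity
  have := abs_log_sub_le_of_esymm (u := 2 * t) (v := 2 * |s|) h3 h32 h21
    (by rw [hE1, e1]; linarith) (by rw [hE1, e1]; linarith)
    (by rw [hE2, e2]; linarith) (by rw [hE2, e2]; linarith) e3
  simp only [abs_le] at this ⊢
  obtain ⟨⟨_, _⟩, ⟨_, _⟩, ⟨_, _⟩⟩ := this
  refine ⟨⟨?_, ?_⟩, ⟨?_, ?_⟩, ⟨?_, ?_⟩⟩ <;> linarith
end
end

section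
/- Let (t_n) and (s_n) be real sequences with t_n → ∞ and |s_n| → ∞, and set g_n = a_{t_n} · k₀ · h_{s_n} ∈ SL(3,ℝ). For each n let v_n ∈ ℝ³ be a unit eigenvector of the symmetric positive definite matrix g_n g_nᵀ corresponding to its largest eigenvalue. Then every limit point of the sequence (v_n) in ℝ³ equals ±(1/√2)(1, 0, 1); i.e., if v_n converges to some v ∈ ℝ³, then v = (1/√2)(1,0,1) or v = −(1/√2)(1,0,1). (In terms of Cartan decompositions g_n = k_n a_n l_n ∈ K A⁺ K, any limit k* of a convergent subsequence of (k_n) maps e₁ to a vector proportional to e₁ + e₃.) -/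
open Matrix Real Filter

noncomputable section

/-- `lam` is the largest eigenvalue of `M`. -/
def IsMaxEigenvalue (M : Matrix (Fin 3) (Fin 3) ℝ) (lam : ℝ) : Prop :=
  (∃ v : Fin 3 → ℝ, v ≠ 0 ∧ M *ᵥ v = lam • v) ∧
  ∀ μ : ℝ, (∃ v : Fin 3 → ℝ, v ≠ 0 ∧ M *ᵥ v = μ • v) → μ ≤ lam

/-- The symmetric matrix `g gᵀ` for `g = a_τ k₀ h_σ`, in the coordinates adapted to
`(1, 0, 1)`, `(0, 1, 0)`, `(1, 0, -1)`. -/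
theorem gram_mulVec (τ σ : ℝ) (u : Fin 3 → ℝ) :
    ((aMat τ * k0Mat * hMat σ) * (aMat τ * k0Mat * hMat σ)ᵀ) *ᵥ u =
      ![exp τ ^ 2 * cosh (2 * σ) * (u 0 + u 2) / 2 + exp τ ^ 2 * (u 0 - u 2) / 2
          - exp τ * exp (-2 * τ) * sinh (2 * σ) * (1 / √2) * u 1,
        - exp τ * exp (-2 * τ) * sinh (2 * σ) * (1 / √2) * (u 0 + u 2)
          + exp (-2 * τ) ^ 2 * cosh (2 * σ) * u 1,
        exp τ ^ 2 * cosh (2 * σ) * (u 0 + u 2) / 2 - exp τ ^ 2 * (u 0 - u 2) / 2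
          - exp τ * exp (-2 * τ) * sinh (2 * σ) * (1 / √2) * u 1] := by
  have hr : (1 / √2) ^ 2 = (1 / 2 : ℝ) := by rw [div_pow]; norm_num
  have hx : exp (2 * σ) = exp σ ^ 2 := by rw [← exp_nat_mul]; norm_num
  have hy : exp (-(2 * σ)) = exp (-σ) ^ 2 := by rw [← exp_nat_mul]; norm_num
  rw [cosh_eq, sinh_eq, hx, hy]
  unfold aMat k0Mat hMat
  generalize 1 / √2 = r at *
  ext i
  fin_cases i <;>
    simp [Matrix.mulVec, dotProduct, Fin.sum_univ_three, Matrix.mul_apply,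
      Matrix.diagonal_apply] <;>
    grind

/-- The largest eigenvalue of `g gᵀ` is at least `e^{2τ} cosh 2σ`. -/
theorem le_of_isMaxEigenvalue_gram {τ σ l : ℝ} (hτ : 0 < τ)
    (hl : IsMaxEigenvalue
      ((aMat τ * k0Mat * hMat σ) * (aMat τ * k0Mat * hMat σ)ᵀ) l) :
    exp τ ^ 2 * cosh (2 * σ) ≤ l := by
  have hr : (1 / √2) ^ 2 = (1 / 2 : ℝ) := by rw [div_pow]; norm_num
  have hpq : exp (-2 * τ) ^ 2 < exp τ ^ 2 := by
    gcongr
    linarith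
  have hC := cosh_pos (2 * σ)
  set A := exp τ ^ 2 * cosh (2 * σ) with hA
  set D := exp (-2 * τ) ^ 2 * cosh (2 * σ) with hD
  set B := exp τ * exp (-2 * τ) * sinh (2 * σ) with hB
  have hDA : D < A := mul_lt_mul_of_pos_right hpq hC
  set R := √((A - D) ^ 2 + 4 * B ^ 2) with hR
  have hR2 : R ^ 2 = (A - D) ^ 2 + 4 * B ^ 2 := sq_sqrt (by positivity)
  have hRge : A - D ≤ R := le_sqrt_of_sq_le (by nlinarith [sq_nonneg B])
  have hμ : (A + D + R) / 2 ≤ l := by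
    refine hl.2 _ ⟨![(1 / √2) * ((A + D + R) / 2 - D), -B, (1 / √2) * ((A + D + R) / 2 - D)],
      ?_, ?_⟩
    · intro h
      have h0 := congrFun h 0
      have hr0 : (1 / √2 : ℝ) ≠ 0 := by positivity
      simp only [Matrix.cons_val_zero, Pi.zero_apply, mul_eq_zero, hr0, false_or] at h0
      linarith
    · rw [gram_mulVec]
      generalize 1 / √2 = r at *
      ext i
      fin_cases i <;> simp <;> grind
  linarith

/-- For a top unit eigenvector `u` of `g gᵀ`, the coordinate along `(1, 0, -1)` vanishes and
the middle coordinate is `O(e^{-τ})`. -/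
theorem top_eigenvector_bound {τ σ l : ℝ} {u : Fin 3 → ℝ} (hτ : 1 ≤ τ) (hσ : σ ≠ 0)
    (hl : IsMaxEigenvalue
      ((aMat τ * k0Mat * hMat σ) * (aMat τ * k0Mat * hMat σ)ᵀ) l)
    (hu : ((aMat τ * k0Mat * hMat σ) * (aMat τ * k0Mat * hMat σ)ᵀ) *ᵥ u = l • u)
    (hunit : u 0 ^ 2 + u 1 ^ 2 + u 2 ^ 2 = 1) :
    u 0 = u 2 ∧ |u 1| ≤ 4 * exp (-τ) := by
  have hle := le_of_isMaxEigenvalue_gram (by linarith) hl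
  rw [gram_mulVec] at hu
  have h0 := congrFun hu 0
  have h1 := congrFun hu 1
  have h2 := congrFun hu 2
  simp only [Matrix.cons_val, Pi.smul_apply, smul_eq_mul] at h0 h1 h2
  have hC : 1 < cosh (2 * σ) := one_lt_cosh.2 (by simpa using hσ)
  have hp : 0 < exp τ := exp_pos τ
  have hp2 : 2 ≤ exp τ := by linarith [add_one_le_exp τ]
  have hq : 0 < exp (-2 * τ) := exp_pos _
  have hq1 : exp (-2 * τ) ≤ 1 := exp_le_one_iff.2 (by linarith)
  have hS : |sinh (2 * σ)| ≤ cosh (2 * σ) :=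
    abs_le_of_sq_le_sq (by linarith [cosh_sq (2 * σ)]) (by linarith)
  have hr : |1 / √2| ≤ (1 : ℝ) := by
    rw [abs_of_pos (by positivity)]
    exact (div_le_one (by positivity)).2 (one_le_sqrt.2 one_le_two)
  have hsum : |u 0 + u 2| ≤ 2 :=
    abs_le_of_sq_le_sq (by nlinarith [sq_nonneg (u 0 - u 2), sq_nonneg (u 1)]) (by norm_num)
  refine ⟨?_, ?_⟩
  · have h : (exp τ ^ 2 - l) * (u 0 - u 2) = 0 := by linear_combination h0 - h2
    rcases mul_eq_zero.1 h with h | h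
    · nlinarith [pow_pos hp 2]
    · linarith
  · generalize exp (-2 * τ) = q at *
    rw [exp_neg, ← div_eq_mul_inv, le_div_iff₀ hp]
    generalize exp τ = p at *
    generalize cosh (2 * σ) = C at *
    have hD : p ^ 2 / 2 * C ≤ l - q ^ 2 * C := by
      have : p ^ 2 / 2 ≤ p ^ 2 - q ^ 2 := by nlinarith
      nlinarith
    have hEq : u 1 * (l - q ^ 2 * C) =
        -(p * q * (sinh (2 * σ) * ((1 / √2) * (u 0 + u 2)))) := by
      linear_combination -h1
    have hB : |sinh (2 * σ) * ((1 / √2) * (u 0 + u 2))| ≤ C * (1 * 2) := by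
      rw [abs_mul, abs_mul]
      gcongr
    have habs : |u 1| * (l - q ^ 2 * C) ≤ p * (C * (1 * 2)) := by
      have hpos : 0 < l - q ^ 2 * C := lt_of_lt_of_le (by positivity) hD
      rw [← abs_of_pos hpos, ← abs_mul, hEq, abs_neg, abs_mul, abs_of_pos (mul_pos hp hq)]
      exact mul_le_mul (by nlinarith) hB (abs_nonneg _) hp.le
    have hfin : |u 1| * (p ^ 2 / 2 * C) ≤ p * (C * (1 * 2)) :=
      (mul_le_mul_of_nonneg_left hD (abs_nonneg _)).trans habs
    have hpC : 0 < p * C / 2 := by positivity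
    exact le_of_mul_le_mul_right (by linarith) hpC

/-- if `t_n → ∞`, `|s_n| → ∞`, `g_n = a_{t_n} k₀ h_{s_n}` and `v_n` is a unit
eigenvector of `g_n g_nᵀ` for its largest eigenvalue, then every limit point of `(v_n)`
is `±(1/√2)(1,0,1)`. -/
theorem top_eigenvector_limit
    (t s : ℕ → ℝ)
    (ht : Tendsto t atTop atTop)
    (hs : Tendsto (fun n => |s n|) atTop atTop)
    (lam : ℕ → ℝ) (v : ℕ → Fin 3 → ℝ)
    (hlam : ∀ n, IsMaxEigenvalue
      ((aMat (t n) * k0Mat * hMat (s n)) * (aMat (t n) * k0Mat * hMat (s n))ᵀ) (lam n))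
    (hv : ∀ n,
      ((aMat (t n) * k0Mat * hMat (s n)) * (aMat (t n) * k0Mat * hMat (s n))ᵀ) *ᵥ v n =
        lam n • v n)
    (hunit : ∀ n, (v n 0)^2 + (v n 1)^2 + (v n 2)^2 = 1)
    (w : Fin 3 → ℝ) (hconv : Tendsto v atTop (nhds w)) :
    w = (1 / Real.sqrt 2) • ![1, 0, 1] ∨ w = -((1 / Real.sqrt 2) • ![1, 0, 1]) := by
  have hev : ∀ᶠ n in atTop, v n 0 = v n 2 ∧ |v n 1| ≤ 4 * exp (-t n) := by
    filter_upwards [ht.eventually_ge_atTop 1, hs.eventually_gt_atTop 0] with n h1 h2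
    exact top_eigenvector_bound h1 (abs_pos.1 h2) (hlam n) (hv n) (hunit n)
  have hc : ∀ i, Tendsto (fun n => v n i) atTop (nhds (w i)) := tendsto_pi_nhds.1 hconv
  have hw02 : w 0 = w 2 :=
    tendsto_nhds_unique ((hc 0).congr' (hev.mono fun _ h => h.1)) (hc 2)
  have hexp : Tendsto (fun n => 4 * exp (-t n)) atTop (nhds 0) := by
    simpa using (tendsto_exp_neg_atTop_nhds_zero.comp ht).const_mul 4
  have hw1 : w 1 = 0 :=
    tendsto_nhds_unique (hc 1) (squeeze_zero_norm' (hev.mono fun _ h => h.2) hexp)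
  have hw : w 0 ^ 2 + w 1 ^ 2 + w 2 ^ 2 = 1 := by
    refine tendsto_nhds_unique ((((hc 0).pow 2).add ((hc 1).pow 2)).add ((hc 2).pow 2)) ?_
    simp only [hunit, tendsto_const_nhds]
  have hr : (1 / √2) ^ 2 = (1 / 2 : ℝ) := by rw [div_pow]; norm_num
  have hsq : w 0 ^ 2 = (1 / √2) ^ 2 := by
    rw [hw1, ← hw02] at hw
    linarith
  rcases sq_eq_sq_iff_eq_or_eq_neg.1 hsq with h | h
  · left
    ext i
    fin_cases i <;> simp [hw1, ← hw02, h]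
  · right
    ext i
    fin_cases i <;> simp [hw1, ← hw02, h]
end
end

section
/- Let (t_n) and (s_n) be real sequences with t_n → ∞ and |s_n| → ∞, and set g_n = a_{t_n} · k₀ · h_{s_n} ∈ SL(3,ℝ). Then the largest eigenvalue λ₁(g_n g_nᵀ) of the symmetric positive definite matrix g_n g_nᵀ satisfies 4 · λ₁(g_n g_nᵀ) / (e^{2 t_n} (e^{s_n} + e^{-s_n})²) → 2 as n → ∞. -/
open Matrix Real Filter

noncomputable section

/-- The symmetric matrix to which `g gᵀ` reduces for `g = a_t k₀ h_s`, with `A = e^t`, `B = e^{-2t}`,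
`u = cosh (2s)` and `d = -sinh (2s) / √2`. -/
def gramMat (A B u d : ℝ) : Matrix (Fin 3) (Fin 3) ℝ :=
  !![A ^ 2 * (u + 1) / 2, A * B * d, A ^ 2 * (u - 1) / 2;
     A * B * d, B ^ 2 * u, A * B * d;
     A ^ 2 * (u - 1) / 2, A * B * d, A ^ 2 * (u + 1) / 2]

lemma gram_eq (t s : ℝ) :
    (aMat t * k0Mat * hMat s) * (aMat t * k0Mat * hMat s)ᵀ =
      gramMat (Real.exp t) (Real.exp (-2 * t)) (Real.cosh (2 * s))
        (-(Real.sinh (2 * s) * (1 / Real.sqrt 2))) := by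
  have hw : (1 / Real.sqrt 2) ^ 2 = 1 / 2 := by
    rw [div_pow, Real.sq_sqrt (by norm_num)]; norm_num
  have hc : Real.cosh (2 * s) = (Real.exp s ^ 2 + Real.exp (-s) ^ 2) / 2 := by
    rw [Real.cosh_eq, ← Real.exp_nat_mul, ← Real.exp_nat_mul]; push_cast; ring_nf
  have hd : Real.sinh (2 * s) = (Real.exp s ^ 2 - Real.exp (-s) ^ 2) / 2 := by
    rw [Real.sinh_eq, ← Real.exp_nat_mul, ← Real.exp_nat_mul]; push_cast; ring_nf
  rw [hc, hd]
  unfold aMat k0Mat hMat gramMat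
  generalize Real.exp s = x at *
  generalize Real.exp (-s) = y at *
  generalize Real.exp t = A at *
  generalize Real.exp (-2 * t) = B at *
  generalize 1 / Real.sqrt 2 = w at *
  ext i j
  fin_cases i <;> fin_cases j <;>
    simp [Matrix.mul_apply, Fin.sum_univ_three, Matrix.diagonal_apply] <;>
    first
    | ring1
    | linear_combination A ^ 2 * hw
    | linear_combination (-A ^ 2) * hw
    | linear_combination B ^ 2 * (x ^ 2 + y ^ 2) * hw

lemma gramMat_mulVec (A B u d : ℝ) (v : Fin 3 → ℝ) (μ : ℝ) :
    gramMat A B u d *ᵥ v = μ • v ↔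
      A ^ 2 * (u + 1) / 2 * v 0 + A * B * d * v 1 + A ^ 2 * (u - 1) / 2 * v 2 = μ * v 0 ∧
      A * B * d * v 0 + B ^ 2 * u * v 1 + A * B * d * v 2 = μ * v 1 ∧
      A ^ 2 * (u - 1) / 2 * v 0 + A * B * d * v 1 + A ^ 2 * (u + 1) / 2 * v 2 = μ * v 2 := by
  simp [funext_iff, Fin.forall_fin_succ, gramMat, dotProduct, Fin.sum_univ_three]

lemma le_maxEigenvalue_gramMat {A B u d lam : ℝ}
    (h : IsMaxEigenvalue (gramMat A B u d) lam) : A ^ 2 * u ≤ lam := by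
  by_cases hQ : A * B * d = 0
  · refine h.2 _ ⟨![1, 0, 1], fun h0 => by simpa using congrFun h0 0, ?_⟩
    rw [gramMat_mulVec]
    simp only [hQ]
    refine ⟨?_, ?_, ?_⟩ <;> simp <;> ring
  · set P := A ^ 2 * u with hP
    set R := B ^ 2 * u with hR
    set Q := A * B * d with hQd
    set r := Real.sqrt ((P - R) ^ 2 + 8 * Q ^ 2) with hr
    have hr2 : r ^ 2 = (P - R) ^ 2 + 8 * Q ^ 2 := Real.sq_sqrt (by positivity)
    have hr1 : P - R ≤ r := Real.le_sqrt_of_sq_le (by nlinarith [sq_nonneg Q])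
    have hev : (P + R + r) / 2 ≤ lam := by
      refine h.2 _ ⟨![Q, (P + R + r) / 2 - P, Q], fun h0 => hQ (by simpa using congrFun h0 0), ?_⟩
      rw [gramMat_mulVec]
      simp only [← hQd, ← hR]
      refine ⟨?_, ?_, ?_⟩ <;> simp
      · rw [hP]; ring
      · linear_combination (-1 / 4) * hr2
      · rw [hP]; ring
    linarith

lemma maxEigenvalue_gramMat_le {A B u d lam : ℝ} (hu : 1 ≤ u) (hd : 2 * d ^ 2 = u ^ 2 - 1)
    (h : IsMaxEigenvalue (gramMat A B u d) lam) : lam ≤ A ^ 2 * u + B ^ 2 * u := by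
  obtain ⟨v, hv, he⟩ := h.1
  rw [gramMat_mulVec] at he
  obtain ⟨e0, e1, e2⟩ := he
  have hP : 0 ≤ A ^ 2 * u := by positivity
  have hR : 0 ≤ B ^ 2 * u := by positivity
  by_cases h02 : v 0 = v 2
  · by_contra! hlt
    rw [← h02] at e0 e1
    have f0 : (lam - A ^ 2 * u) * v 0 = A * B * d * v 1 := by linear_combination -e0
    have f1 : (lam - B ^ 2 * u) * v 1 = 2 * (A * B * d) * v 0 := by linear_combination -e1
    have hdet : 0 < (lam - A ^ 2 * u) * (lam - B ^ 2 * u) - 2 * (A * B * d) ^ 2 := by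
      have : (lam - A ^ 2 * u) * (lam - B ^ 2 * u) - 2 * (A * B * d) ^ 2 =
          lam * (lam - (A ^ 2 * u + B ^ 2 * u)) + (A * B) ^ 2 := by
        linear_combination (-(A * B) ^ 2) * hd
      rw [this]
      have : 0 < lam * (lam - (A ^ 2 * u + B ^ 2 * u)) :=
        mul_pos (by linarith) (by linarith)
      positivity
    have g0 : v 0 = 0 := (mul_eq_zero.1 (show
      ((lam - A ^ 2 * u) * (lam - B ^ 2 * u) - 2 * (A * B * d) ^ 2) * v 0 = 0 by
        linear_combination (lam - B ^ 2 * u) * f0 + A * B * d * f1)).resolve_left hdet.ne'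
    have g1 : v 1 = 0 := (mul_eq_zero.1 (show
      ((lam - A ^ 2 * u) * (lam - B ^ 2 * u) - 2 * (A * B * d) ^ 2) * v 1 = 0 by
        linear_combination (lam - A ^ 2 * u) * f1 + 2 * (A * B * d) * f0)).resolve_left hdet.ne'
    apply hv
    ext i
    fin_cases i
    · exact g0
    · exact g1
    · exact h02.symm.trans g0
  · have : lam = A ^ 2 := mul_right_cancel₀ (sub_ne_zero.2 h02) (by linear_combination e2 - e0)
    nlinarith [sq_nonneg A]

/-- for `t_n → ∞`, `|s_n| → ∞` and `g_n = a_{t_n} k₀ h_{s_n}`, the largest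
eigenvalue `λ₁(g_n g_nᵀ)` satisfies `4 λ₁(g_n g_nᵀ) / (e^{2t_n}(e^{s_n}+e^{-s_n})²) → 2`. -/
theorem top_eigenvalue_asymptotics
    (t s : ℕ → ℝ)
    (ht : Tendsto t atTop atTop)
    (hs : Tendsto (fun n => |s n|) atTop atTop)
    (lam : ℕ → ℝ)
    (hlam : ∀ n, IsMaxEigenvalue
      ((aMat (t n) * k0Mat * hMat (s n)) * (aMat (t n) * k0Mat * hMat (s n))ᵀ) (lam n)) :
    Tendsto (fun n =>
      4 * lam n / (Real.exp (2 * t n) * (Real.exp (s n) + Real.exp (-(s n)))^2))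
      atTop (nhds 2) := by
  have hcosh : Tendsto (fun n => Real.cosh (2 * s n)) atTop atTop := by
    refine tendsto_atTop_mono (fun n => ?_) hs
    have h1 := Real.add_one_le_exp (2 * |s n|)
    have h2 := Real.exp_pos (-(2 * |s n|))
    have h3 : Real.cosh (2 * s n) = Real.cosh (2 * |s n|) := by
      rw [← Real.cosh_abs, abs_mul, abs_two]
    rw [h3, Real.cosh_eq]
    linarith
  have hinv : Tendsto (fun n => 2 / (Real.cosh (2 * s n) + 1)) atTop (nhds 0) :=
    (tendsto_atTop_add_const_right _ 1 hcosh).const_div_atTop 2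
  have hexp : Tendsto (fun n => Real.exp (-6 * t n)) atTop (nhds 0) :=
    Real.tendsto_exp_atBot.comp (ht.const_mul_atTop_of_neg (by norm_num))
  have hlow : Tendsto (fun n => 2 - 2 / (Real.cosh (2 * s n) + 1)) atTop (nhds 2) := by
    simpa using hinv.const_sub 2
  have hupp : Tendsto (fun n => 2 + 2 * Real.exp (-6 * t n)) atTop (nhds 2) := by
    simpa using (hexp.const_mul 2).const_add 2
  have hden (n : ℕ) : Real.exp (2 * t n) * (Real.exp (s n) + Real.exp (-(s n))) ^ 2 =
      2 * (Real.exp (t n) ^ 2 * (Real.cosh (2 * s n) + 1)) := by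
    have h1 : Real.exp (2 * t n) = Real.exp (t n) ^ 2 := by
      rw [← Real.exp_nat_mul]; push_cast; rfl
    have h2 : Real.exp (s n) + Real.exp (-(s n)) = 2 * Real.cosh (s n) := by
      rw [Real.cosh_eq]; ring
    rw [h1, h2, Real.cosh_two_mul, Real.sinh_sq]; ring
  refine tendsto_of_tendsto_of_tendsto_of_le_of_le hlow hupp (fun n => ?_) (fun n => ?_)
  · have hl := hlam n
    rw [gram_eq] at hl
    have hle := le_maxEigenvalue_gramMat hl
    have hu := Real.one_le_cosh (2 * s n)
    have hA := Real.exp_pos (t n)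
    dsimp only
    rw [hden, le_div_iff₀ (by positivity)]
    field_simp
    linarith
  · have hl := hlam n
    rw [gram_eq] at hl
    have hu := Real.one_le_cosh (2 * s n)
    have hA := Real.exp_pos (t n)
    have hle := maxEigenvalue_gramMat_le hu (by
      rw [neg_sq, mul_pow, div_pow, Real.sq_sqrt (by norm_num), Real.sinh_sq]; ring) hl
    have hB : Real.exp (-2 * t n) ^ 2 = Real.exp (-6 * t n) * Real.exp (t n) ^ 2 := by
      rw [← Real.exp_nat_mul, ← Real.exp_nat_mul, ← Real.exp_add]; push_cast; ring_nf
    rw [hB] at hle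
    dsimp only
    rw [hden, div_le_iff₀ (by positivity)]
    have hE : 0 < Real.exp (-6 * t n) * Real.exp (t n) ^ 2 := by positivity
    have hA2 : 0 < Real.exp (t n) ^ 2 := by positivity
    linarith
end
end

section
/- Let t ≠ 0 and θ, r ∈ ℝ, and set q = a_t · k₀ · k(θ) · h_r ∈ SL(3,ℝ). If X ∈ 𝔥 is such that the matrix q⁻¹ X q belongs to the subspace k(θ)⁻¹ 𝔞₀ k(θ) + 𝔨₀ of M₃(ℝ), then X = 0. Equivalently, for t ≠ 0 the subspaces q⁻¹ 𝔥 q and k(θ)⁻¹ 𝔞₀ k(θ) + 𝔨₀ of M₃(ℝ) intersect trivially. (This is the key linear-algebra step showing that for t ≠ 0 the product map H × a_t k₀ A₀ K₀ → SL(3,ℝ) is a local diffeomorphism onto its image.) -/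
open Matrix Real

noncomputable section

/-- the rotation `k(θ)` -/
def kMat (θ : ℝ) : Matrix (Fin 3) (Fin 3) ℝ :=
  !![(1 + Real.cos θ)/2, -(Real.sqrt 2 / 2) * Real.sin θ, (1 - Real.cos θ)/2;
     (Real.sqrt 2 / 2) * Real.sin θ, Real.cos θ, -(Real.sqrt 2 / 2) * Real.sin θ;
     (1 - Real.cos θ)/2, (Real.sqrt 2 / 2) * Real.sin θ, (1 + Real.cos θ)/2]

/-- The generator `diag(1,0,-1)` of `𝔞₀`. -/
def a0Gen : Matrix (Fin 3) (Fin 3) ℝ := Matrix.diagonal ![1, 0, -1]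

/-- The generator of `𝔨₀`. -/
def k0Gen : Matrix (Fin 3) (Fin 3) ℝ := !![0, 1, 0; -1, 0, 1; 0, -1, 0]

/-- The element of `𝔥` with coordinates `s`, `x`, `y`. -/
def hElem (s x y : ℝ) : Matrix (Fin 3) (Fin 3) ℝ :=
  !![s, x, 0; y, 0, x; 0, y, -s]

theorem kMat_mul_hElem (φ s x y : ℝ) :
    kMat φ * hElem s x y =
      hElem (s * cos φ - √2 * sin φ * ((x + y) / 2))
        ((x + y) / 2 * cos φ + √2 / 2 * sin φ * s + (x - y) / 2)
        ((x + y) / 2 * cos φ + √2 / 2 * sin φ * s - (x - y) / 2) * kMat φ := by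
  have h2 : √2 ^ 2 = (2 : ℝ) := Real.sq_sqrt (by norm_num)
  have h1 := Real.sin_sq_add_cos_sq φ
  ext i j
  fin_cases i <;> fin_cases j <;>
    simp [kMat, hElem, Matrix.mul_apply, Fin.sum_univ_three] <;> grind

theorem hMat_mul_hElem (r s x y : ℝ) :
    hMat r * hElem s x y = hElem s (exp r * x) (exp (-r) * y) * hMat r := by
  have h1 : exp r * exp (-r) = 1 := by rw [← Real.exp_add]; simp
  ext i j
  fin_cases i <;> fin_cases j <;>
    simp [hMat, hElem, Matrix.mul_apply, Matrix.diagonal] <;> grind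

theorem kMat_neg_mul_kMat (φ : ℝ) : kMat (-φ) * kMat φ = 1 := by
  have h2 : √2 ^ 2 = (2 : ℝ) := Real.sq_sqrt (by norm_num)
  have h1 := Real.sin_sq_add_cos_sq φ
  ext i j
  fin_cases i <;> fin_cases j <;>
    simp [kMat, Matrix.mul_apply, Fin.sum_univ_three] <;> grind

theorem kMat_inv (φ : ℝ) : (kMat φ)⁻¹ = kMat (-φ) :=
  Matrix.inv_eq_left_inv (kMat_neg_mul_kMat φ)

theorem k0Mat_eq_kMat : k0Mat = kMat (-(π / 2)) := by
  have h2 : √2 ^ 2 = (2 : ℝ) := Real.sq_sqrt (by norm_num)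
  have h3 : (√2)⁻¹ = √2 / 2 := by
    field_simp
    exact h2.symm
  ext i j
  fin_cases i <;> fin_cases j <;> simp [kMat, k0Mat, h3]

theorem isUnit_kMat (φ : ℝ) : IsUnit (kMat φ) :=
  IsUnit.of_mul_eq_one_right _ (kMat_neg_mul_kMat φ)

theorem isUnit_aMat (t : ℝ) : IsUnit (aMat t) := by
  rw [Matrix.isUnit_iff_isUnit_det, aMat, Matrix.det_diagonal, isUnit_iff_ne_zero]
  simp [Fin.prod_univ_three]

theorem isUnit_hMat (r : ℝ) : IsUnit (hMat r) := by
  rw [Matrix.isUnit_iff_isUnit_det, hMat, Matrix.det_diagonal, isUnit_iff_ne_zero]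
  simp [Fin.prod_univ_three]

/-- For `t ≠ 0`, an element of `𝔥` stays in `𝔥` under conjugation by `a_t` only if it is
diagonal. -/
theorem hElem_mul_aMat_eq {t : ℝ} (ht : t ≠ 0) {s x y s' x' y' : ℝ}
    (h : hElem s x y * aMat t = aMat t * hElem s' x' y') :
    s = s' ∧ x = 0 ∧ y = 0 ∧ x' = 0 ∧ y' = 0 := by
  have hne : exp t ≠ exp (-2 * t) := fun h' => ht (by linarith [Real.exp_injective h'])
  have hp := exp_pos t
  have hq := exp_pos (-2 * t)
  have e00 := congrFun (congrFun h 0) 0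
  have e01 := congrFun (congrFun h 0) 1
  have e10 := congrFun (congrFun h 1) 0
  have e12 := congrFun (congrFun h 1) 2
  have e21 := congrFun (congrFun h 2) 1
  simp only [hElem, aMat, Matrix.mul_diagonal, Matrix.diagonal_mul] at e00 e01 e10 e12 e21
  simp only [Matrix.of_apply, Matrix.cons_val] at e00 e01 e10 e12 e21
  generalize exp t = p at *
  generalize exp (-2 * t) = q at *
  have hd : (p - q) * (p + q) ≠ 0 := mul_ne_zero (sub_ne_zero.2 hne) (by positivity)
  have cancel : ∀ z : ℝ, (p - q) * (p + q) * z = 0 → z = 0 := fun z hz =>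
    (mul_eq_zero.1 hz).resolve_left hd
  refine ⟨mul_right_cancel₀ hp.ne' (by linarith), cancel _ ?_, cancel _ ?_, cancel _ ?_,
    cancel _ ?_⟩
  · linear_combination p * e12 - q * e01
  · linear_combination p * e10 - q * e21
  · linear_combination q * e12 - p * e01
  · linear_combination q * e10 - p * e21

/-- for `t ≠ 0`, `q = a_t k₀ k(θ) h_r`, if `X ∈ 𝔥` and
`q⁻¹ X q ∈ k(θ)⁻¹ 𝔞₀ k(θ) + 𝔨₀`, then `X = 0`. -/
theorem transversality_of_h_and_rotated_a0_k0
    (t : ℝ) (ht : t ≠ 0) (θ r : ℝ)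
    (X : Matrix (Fin 3) (Fin 3) ℝ)
    (hX : ∃ s x y : ℝ, X = !![s, x, 0; y, 0, x; 0, y, -s])
    (hmem : ∃ a b : ℝ,
      (aMat t * k0Mat * kMat θ * hMat r)⁻¹ * X * (aMat t * k0Mat * kMat θ * hMat r) =
        (kMat θ)⁻¹ * (a • a0Gen) * kMat θ + b • k0Gen) :
    X = 0 := by
  obtain ⟨s, x, y, rfl⟩ := hX
  obtain ⟨a, b, h⟩ := hmem
  have hgen : a • a0Gen = hElem a 0 0 ∧ b • k0Gen = hElem 0 b (-b) := by
    constructor <;> ext i j <;> fin_cases i <;> fin_cases j <;> simp [a0Gen, k0Gen, hElem]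
  have hadd : ∀ s x y s' x' y', hElem s x y + hElem s' x' y' =
      hElem (s + s') (x + x') (y + y') := by
    intro s x y s' x' y'
    ext i j
    fin_cases i <;> fin_cases j <;> simp [hElem, add_comm]
  have hQ : IsUnit (aMat t * kMat (-(π / 2)) * kMat θ * hMat r) :=
    (((isUnit_aMat t).mul (isUnit_kMat _)).mul (isUnit_kMat θ)).mul (isUnit_hMat r)
  rw [k0Mat_eq_kMat, hgen.1, hgen.2, kMat_inv, kMat_mul_hElem, Matrix.mul_assoc (hElem _ _ _),
    kMat_neg_mul_kMat, Matrix.mul_one, hadd, Matrix.mul_assoc] at h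
  have h' := congrArg (aMat t * kMat (-(π / 2)) * kMat θ * hMat r * ·) h
  simp only [Matrix.mul_nonsing_inv_cancel_left _ _ ((Matrix.isUnit_iff_isUnit_det _).1 hQ)] at h'
  simp only [← Matrix.mul_assoc] at h'
  rw [Matrix.mul_assoc _ (hMat r), hMat_mul_hElem, ← Matrix.mul_assoc _ (hElem _ _ _),
    Matrix.mul_assoc _ (kMat θ) (hElem _ _ _), kMat_mul_hElem, ← Matrix.mul_assoc _ (hElem _ _ _),
    Matrix.mul_assoc _ (kMat _) (hElem _ _ _), kMat_mul_hElem,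
    ← Matrix.mul_assoc _ (hElem _ _ _)] at h'
  replace h' := (isUnit_kMat _).mul_right_cancel
    ((isUnit_kMat _).mul_right_cancel ((isUnit_hMat _).mul_right_cancel h'))
  obtain ⟨hs, rfl, rfl, hx, hy⟩ := hElem_mul_aMat_eq ht h'
  simp only [Real.cos_neg, Real.sin_neg, Real.cos_pi_div_two, Real.sin_pi_div_two] at hs hx hy
  clear h h' hQ hgen hadd
  have h2 : √2 ^ 2 = (2 : ℝ) := Real.sq_sqrt (by norm_num)
  have hexp : exp r * exp (-r) = 1 := by rw [← Real.exp_add]; simp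
  have hp := exp_pos r
  have hq := exp_pos (-r)
  have h1 := Real.sin_sq_add_cos_sq θ
  generalize exp r = p at *
  generalize exp (-r) = q at *
  generalize cos θ = c at *
  generalize sin θ = d at *
  have he : √2 ≠ 0 := by positivity
  generalize √2 = e at *
  generalize hn : -(e / 2 * d * a) = n
  generalize hm : p * (n + b) = m
  have hxy : p * (n + b) = q * (n - b) := by subst hn; linear_combination hx - hy
  have hz : c ^ 2 * a = e * d * m := by
    apply mul_left_cancel₀ he
    subst hm hn
    linear_combination -(hx + hy) - e ^ 2 * d / 2 * hxy
  have hmn : (p + q) * m = 2 * n := by grind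
  have ha : a * (c ^ 2 * (p + q) + 2 * d ^ 2) = 0 := by grind
  have hpos : 0 < c ^ 2 * (p + q) + 2 * d ^ 2 := by
    rcases eq_or_ne d 0 with rfl | hd
    · have : c ^ 2 = 1 := by linarith
      rw [this]
      positivity
    · positivity
  have ha0 : a = 0 := (mul_eq_zero.1 ha).resolve_right hpos.ne'
  have hm0 : m = 0 := by
    have : (p + q) * m = 0 := by rw [hmn, ← hn, ha0]; ring
    exact (mul_eq_zero.1 this).resolve_left (by positivity)
  have hs0 : s = 0 := by
    linear_combination hs + e * c * (hm + hm0) - e * c / 2 * hxy + (p + q) / 2 * e * c * hn +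
      e ^ 2 / 2 * d * c * ha0
  ext i j
  fin_cases i <;> fin_cases j <;> simp [hs0]
end
end

section
/- Let D = diag(1, 0, -1) and w₀ = [[0, 0, 1], [0, -1, 0], [1, 0, 0]]. A matrix k ∈ SO(3) satisfies k D kᵀ ∈ ℝ·D if and only if k is one of the eight matrices g or w₀·g, where g ranges over the four diagonal matrices {I, diag(-1, 1, -1), diag(1, -1, -1), diag(-1, -1, 1)}. (That is, the normalizer of the line ℝ·D under conjugation by SO(3) is the 8-element subgroup generated by the diagonal matrices of SO(3) together with w₀.) -/
open Matrix

noncomputable section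

/-- `D = diag(1,0,-1)` -/
def Dmat : Matrix (Fin 3) (Fin 3) ℝ := Matrix.diagonal ![1, 0, -1]

/-- `w₀` -/
def w0Mat : Matrix (Fin 3) (Fin 3) ℝ := !![0, 0, 1; 0, -1, 0; 1, 0, 0]

/-- If `k D = c D k`, the entries of `k` off the matching weights `d j = c * d i` vanish. -/
lemma apply_mul_sub_eq_zero_of_mul_diagonal {n : Type*} [Fintype n] [DecidableEq n]
    {k : Matrix n n ℝ} {d : n → ℝ} {c : ℝ}
    (h : k * Matrix.diagonal d = c • (Matrix.diagonal d * k)) (i j : n) :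
    k i j * (d j - c * d i) = 0 := by
  have := congrFun (congrFun h i) j
  simp only [Matrix.mul_diagonal, Matrix.smul_apply, Matrix.diagonal_mul, smul_eq_mul] at this
  linear_combination this

/-- a matrix `k ∈ SO(3)` conjugates the line `ℝ·diag(1,0,-1)` into itself
iff `k` is one of the eight matrices `g` or `w₀ g` with `g` a diagonal matrix in `SO(3)`. -/
theorem normalizer_of_a0_line_in_SO3
    (k : Matrix (Fin 3) (Fin 3) ℝ)
    (hortho : kᵀ * k = 1) (hdet : k.det = 1) :
    (∃ c : ℝ, k * Dmat * kᵀ = c • Dmat) ↔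
      (k = 1 ∨ k = Matrix.diagonal ![-1, 1, -1] ∨ k = Matrix.diagonal ![1, -1, -1] ∨
        k = Matrix.diagonal ![-1, -1, 1] ∨
        k = w0Mat ∨ k = w0Mat * Matrix.diagonal ![-1, 1, -1] ∨
        k = w0Mat * Matrix.diagonal ![1, -1, -1] ∨
        k = w0Mat * Matrix.diagonal ![-1, -1, 1]) := by
  constructor
  · rintro ⟨c, hc⟩
    have hcomm : k * Matrix.diagonal ![1, 0, -1] = c • (Matrix.diagonal ![1, 0, -1] * k) := by
      have := congrArg (· * k) hc
      simpa only [Dmat, Matrix.mul_assoc, hortho, Matrix.mul_one, Matrix.smul_mul] using this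
    have hk := apply_mul_sub_eq_zero_of_mul_diagonal hcomm
    have hcol (j : Fin 3) : k 0 j ^ 2 + k 1 j ^ 2 + k 2 j ^ 2 = 1 := by
      have := congrFun (congrFun hortho j) j
      simp only [Matrix.mul_apply, Fin.sum_univ_three, Matrix.transpose_apply,
        Matrix.one_apply_eq] at this
      linear_combination this
    have h00 : k 0 0 * (1 - c) = 0 := by simpa using hk 0 0
    have h01 : k 0 1 = 0 ∨ c = 0 := by simpa using hk 0 1
    have h02 : k 0 2 * (-1 - c) = 0 := by simpa using hk 0 2
    have h10 : k 1 0 = 0 := by simpa using hk 1 0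
    have h12 : k 1 2 = 0 := by simpa using hk 1 2
    have h20 : k 2 0 * (1 + c) = 0 := by simpa using hk 2 0
    have h21 : k 2 1 = 0 ∨ c = 0 := by simpa using hk 2 1
    have h22 : k 2 2 * (-1 + c) = 0 := by simpa using hk 2 2
    have hc0 := hcol 0
    have hc1 := hcol 1
    have hc2 := hcol 2
    have hsign : c = 1 ∨ c = -1 := by
      by_contra! hne
      have e0 : k 0 0 = 0 :=
        (mul_eq_zero.mp h00).resolve_right fun h => hne.1 (by linarith)
      have e2 : k 2 0 = 0 :=
        (mul_eq_zero.mp h20).resolve_right fun h => hne.2 (by linarith)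
      simp [e0, h10, e2] at hc0
    have hcne : c ≠ 0 := by rcases hsign with rfl | rfl <;> norm_num
    replace h01 := h01.resolve_right hcne
    replace h21 := h21.resolve_right hcne
    rw [Matrix.det_fin_three] at hdet
    rw [Matrix.eta_fin_three k]
    rcases hsign with rfl | rfl
    · have h02 : k 0 2 = 0 := by linarith
      have h20 : k 2 0 = 0 := by linarith
      simp only [h01, h02, h10, h12, h20, h21] at hc0 hc1 hc2 hdet ⊢
      have s0 : k 0 0 = 1 ∨ k 0 0 = -1 := sq_eq_one_iff.mp (by linarith)
      have s1 : k 1 1 = 1 ∨ k 1 1 = -1 := sq_eq_one_iff.mp (by linarith)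
      have s2 : k 2 2 = 1 ∨ k 2 2 = -1 := sq_eq_one_iff.mp (by linarith)
      rcases s0 with s0 | s0 <;> rcases s1 with s1 | s1 <;> rcases s2 with s2 | s2 <;>
        rw [s0, s1, s2] at hdet ⊢ <;> norm_num at hdet
      · exact Or.inl (by ext i j; fin_cases i <;> fin_cases j <;> simp)
      · exact Or.inr (Or.inr (Or.inl (by ext i j; fin_cases i <;> fin_cases j <;> simp)))
      · exact Or.inr (Or.inl (by ext i j; fin_cases i <;> fin_cases j <;> simp))
      · exact Or.inr (Or.inr (Or.inr (Or.inl
          (by ext i j; fin_cases i <;> fin_cases j <;> simp))))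
    · have h00 : k 0 0 = 0 := by linarith
      have h22 : k 2 2 = 0 := by linarith
      simp only [h00, h01, h10, h12, h21, h22] at hc0 hc1 hc2 hdet ⊢
      have s0 : k 0 2 = 1 ∨ k 0 2 = -1 := sq_eq_one_iff.mp (by linarith)
      have s1 : k 1 1 = 1 ∨ k 1 1 = -1 := sq_eq_one_iff.mp (by linarith)
      have s2 : k 2 0 = 1 ∨ k 2 0 = -1 := sq_eq_one_iff.mp (by linarith)
      iterate 4 right
      rcases s0 with s0 | s0 <;> rcases s1 with s1 | s1 <;> rcases s2 with s2 | s2 <;>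
        rw [s0, s1, s2] at hdet ⊢ <;> norm_num at hdet
      · exact Or.inr (Or.inr (Or.inr
          (by ext i j; fin_cases i <;> fin_cases j <;> simp [w0Mat])))
      · exact Or.inl (by ext i j; fin_cases i <;> fin_cases j <;> simp [w0Mat])
      · exact Or.inr (Or.inr (Or.inl
          (by ext i j; fin_cases i <;> fin_cases j <;> simp [w0Mat])))
      · exact Or.inr (Or.inl (by ext i j; fin_cases i <;> fin_cases j <;> simp [w0Mat]))
  · rintro (rfl | rfl | rfl | rfl | rfl | rfl | rfl | rfl)
    iterate 4
      refine ⟨1, ?_⟩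
      ext i j
      fin_cases i <;> fin_cases j <;> simp [Dmat]
    all_goals
      refine ⟨-1, ?_⟩
      ext i j
      fin_cases i <;> fin_cases j <;>
        simp [Dmat, w0Mat, Matrix.mul_apply, Fin.sum_univ_three, Matrix.vecMul_diagonal]
end
end

section
/- Let F₂ be the free group on two generators a, b acting by isometries on a metric space (X, d), let o ∈ X, and suppose there exists a constant c > 1 such that d(o, w·o) ≥ |w|/c − c for every w ∈ F₂, where |w| denotes the word length of w (the length of its reduced word in a^{±1}, b^{±1}). For each n ≥ 1 let Γ_n ≤ F₂ be the subgroup generated by aⁿ and bⁿ, and define δ_n = limsup_{T → ∞} (1/T)·log #{w ∈ Γ_n : d(o, w·o) < T} (each such set is finite by the displacement lower bound). Then there exists a constant c' > 0, depending only on c, such that δ_n ≤ c'/n for all n ≥ 1; in particular δ_n → 0 as n → ∞. -/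
open Filter Real

noncomputable section

namespace FreeGroup

variable {α : Type*}

/-- The endomorphism of a free group raising every generator to the power `n`. -/
def powGenerators (α : Type*) (n : ℕ) : FreeGroup α →* FreeGroup α :=
  lift fun a => of a ^ n

theorem powGenerators_mk (n : ℕ) (L : List (α × Bool)) :
    powGenerators α n (mk L) = mk (L.flatMap (List.replicate n)) := by
  induction L with
  | nil => simp [powGenerators, one_eq_mk]
  | cons x L ih =>
    have hx : ∀ k : ℕ, (mk (List.replicate k x) : FreeGroup α) = mk [x] ^ k := by
      intro k
      induction k with
      | zero => simp [one_eq_mk]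
      | succ k ihk => rw [pow_succ', ← ihk, mul_mk]; rfl
    rw [List.flatMap_cons, ← mul_mk, ← ih, hx, ← List.singleton_append, ← mul_mk, _root_.map_mul]
    congr 1
    rcases x with ⟨a, _ | _⟩
    · have : (mk [(a, false)] : FreeGroup α) = (of a)⁻¹ := rfl
      simp [this, powGenerators]
    · have : (mk [(a, true)] : FreeGroup α) = of a := rfl
      simp [this, powGenerators]

theorem IsReduced.flatMap_replicate {L : List (α × Bool)} (hL : IsReduced L) {n : ℕ}
    (hn : n ≠ 0) : IsReduced (L.flatMap (List.replicate n)) := by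
  rw [IsReduced, List.flatMap_def, List.isChain_flatten (by simp [hn])]
  refine ⟨?_, ?_⟩
  · intro l hl
    obtain ⟨x, -, rfl⟩ := List.mem_map.1 hl
    exact List.isChain_replicate_of_rel n fun _ => rfl
  · rw [List.isChain_map]
    refine List.IsChain.imp (fun x y hxy => ?_) hL
    simpa [List.getLast?_replicate, List.head?_replicate, hn] using hxy

theorem norm_powGenerators [DecidableEq α] {n : ℕ} (hn : n ≠ 0) (v : FreeGroup α) :
    (powGenerators α n v).norm = n * v.norm := by
  have h : (powGenerators α n v).toWord = v.toWord.flatMap (List.replicate n) := by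
    conv_lhs => rw [← mk_toWord (x := v), powGenerators_mk, toWord_mk]
    exact (isReduced_toWord.flatMap_replicate hn).reduce_eq
  simp [norm, h, List.length_flatMap, mul_comm]

theorem range_powGenerators (n : ℕ) :
    (powGenerators α n).range = Subgroup.closure (Set.range fun a => of a ^ n) :=
  range_lift_eq_closure

section Ball

variable [DecidableEq α]

theorem injOn_getElem?_toWord (m : ℕ) :
    Set.InjOn (fun (v : FreeGroup α) (i : Fin m) => v.toWord[(i : ℕ)]?) {v | v.norm ≤ m} := by
  intro v hv w hw hvw
  refine toWord_injective (List.ext_getElem? fun i => ?_)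
  rcases lt_or_ge i m with hi | hi
  · exact congrFun hvw ⟨i, hi⟩
  · rw [List.getElem?_eq_none (le_trans hv hi), List.getElem?_eq_none (le_trans hw hi)]

theorem finite_norm_le [Finite α] (m : ℕ) : {v : FreeGroup α | v.norm ≤ m}.Finite :=
  Set.Finite.of_injOn (Set.mapsTo_univ _ _) (injOn_getElem?_toWord m) Set.finite_univ

theorem ncard_norm_le [Fintype α] (m : ℕ) :
    {v : FreeGroup α | v.norm ≤ m}.ncard ≤ (Fintype.card α * 2 + 1) ^ m := by
  refine (Set.ncard_le_ncard_of_injOn _ (fun _ _ => Set.mem_univ _)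
    (injOn_getElem?_toWord m)).trans_eq ?_
  simp [Set.ncard_univ]

theorem ncard_range_powGenerators_norm_le [Fintype α] {n : ℕ} (hn : n ≠ 0) (m : ℕ) :
    {w : FreeGroup α | w ∈ (powGenerators α n).range ∧ w.norm ≤ m}.ncard ≤
      (Fintype.card α * 2 + 1) ^ (m / n) := by
  refine le_trans ?_ (ncard_norm_le (α := α) (m / n))
  refine le_trans (Set.ncard_le_ncard ?_ ((finite_norm_le (m / n)).image (powGenerators α n)))
    (Set.ncard_image_le (finite_norm_le _))
  rintro _ ⟨⟨v, rfl⟩, hv⟩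
  refine ⟨v, ?_, rfl⟩
  rw [norm_powGenerators hn] at hv
  rwa [Set.mem_ofPred_eq, Nat.le_div_iff_mul_le (Nat.pos_of_ne_zero hn), mul_comm]

end Ball

end FreeGroup

section Displacement

variable {X : Type*} [MetricSpace X] {φ : FreeGroup (Fin 2) →* (X ≃ᵢ X)} {o : X} {c : ℝ}

theorem log_ncard_closure_pow_le (hc : 0 < c)
    (h : ∀ w : FreeGroup (Fin 2), (FreeGroup.norm w : ℝ) / c - c ≤ dist o (φ w o))
    {n : ℕ} (hn : n ≠ 0) {T : ℝ} (hT : 0 ≤ T) :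
    Real.log (Set.ncard {w : FreeGroup (Fin 2) |
      w ∈ Subgroup.closure {FreeGroup.of 0 ^ n, FreeGroup.of 1 ^ n} ∧ dist o (φ w o) < T}) ≤
      c * (T + c) / n * Real.log 5 := by
  set S := {w : FreeGroup (Fin 2) |
      w ∈ Subgroup.closure {FreeGroup.of 0 ^ n, FreeGroup.of 1 ^ n} ∧ dist o (φ w o) < T}
  set m := ⌊c * (T + c)⌋₊
  have hgen : Subgroup.closure {FreeGroup.of 0 ^ n, FreeGroup.of 1 ^ n} =
      (FreeGroup.powGenerators (Fin 2) n).range := by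
    rw [FreeGroup.range_powGenerators]
    congr 1
    ext x
    simp [eq_comm]
  have hsub : S ⊆ {w | w ∈ (FreeGroup.powGenerators (Fin 2) n).range ∧ w.norm ≤ m} := by
    rintro w ⟨hw, hd⟩
    refine ⟨hgen ▸ hw, Nat.le_floor ?_⟩
    have := (h w).trans_lt hd
    rw [sub_lt_iff_lt_add, div_lt_iff₀ hc] at this
    linarith
  have hcard : S.ncard ≤ 5 ^ (m / n) :=
    (Set.ncard_le_ncard hsub ((FreeGroup.finite_norm_le m).subset fun _ hw => hw.2)).trans
      (FreeGroup.ncard_range_powGenerators_norm_le hn m)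
  have hexp : ((m / n : ℕ) : ℝ) ≤ c * (T + c) / n :=
    Nat.cast_div_le.trans (by gcongr; exact Nat.floor_le (by positivity))
  have hlog : Real.log S.ncard ≤ (m / n : ℕ) * Real.log 5 := by
    rcases Nat.eq_zero_or_pos S.ncard with h0 | h0
    · rw [h0, Nat.cast_zero, Real.log_zero]
      positivity
    · rw [← Real.log_pow]
      exact Real.log_le_log (by exact_mod_cast h0) (by exact_mod_cast hcard)
  exact hlog.trans (by gcongr)

end Displacement

/-- if the free group `F₂ = ⟨a,b⟩` acts by isometries on a metric space
with the quasi-isometric displacement lower bound `d(o, w·o) ≥ |w|/c - c`, then the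
critical exponents `δ_n` of the subgroups `Γ_n = ⟨aⁿ, bⁿ⟩` satisfy `δ_n ≤ c'/n` for a
constant `c' > 0` depending only on `c`; in particular `δ_n → 0`. -/
theorem schottky_powers_critical_exponent_tendsto_zero :
    ∀ c : ℝ, 1 < c → ∃ c' : ℝ, 0 < c' ∧
      ∀ (X : Type) [MetricSpace X], ∀ (φ : FreeGroup (Fin 2) →* (X ≃ᵢ X)) (o : X),
        (∀ w : FreeGroup (Fin 2), (FreeGroup.norm w : ℝ) / c - c ≤ dist o (φ w o)) →
        (let δ : ℕ → ℝ := fun n =>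
          Filter.limsup (fun T : ℝ => (1 / T) * Real.log
            (Set.ncard {w : FreeGroup (Fin 2) |
              w ∈ Subgroup.closure {FreeGroup.of 0 ^ n, FreeGroup.of 1 ^ n} ∧
              dist o (φ w o) < T})) Filter.atTop
        (∀ n : ℕ, 1 ≤ n → δ n ≤ c' / n) ∧
          Filter.Tendsto δ Filter.atTop (nhds 0)) := by
  intro c hc
  have hc0 : 0 < c := by linarith
  have hlog5 : 0 < Real.log 5 := Real.log_pos (by norm_num)
  refine ⟨2 * c * Real.log 5, by positivity, ?_⟩
  intro X _ φ o h δ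
  have hnonneg : ∀ n : ℕ, ∀ᶠ T : ℝ in atTop, 0 ≤ (1 / T) * Real.log
      (Set.ncard {w : FreeGroup (Fin 2) |
        w ∈ Subgroup.closure {FreeGroup.of 0 ^ n, FreeGroup.of 1 ^ n} ∧
        dist o (φ w o) < T}) := fun n => by
    filter_upwards [eventually_ge_atTop 0] with T hT
    exact mul_nonneg (by positivity) (Real.log_natCast_nonneg _)
  have hbound : ∀ n : ℕ, 1 ≤ n → ∀ᶠ T : ℝ in atTop, (1 / T) * Real.log
      (Set.ncard {w : FreeGroup (Fin 2) |
        w ∈ Subgroup.closure {FreeGroup.of 0 ^ n, FreeGroup.of 1 ^ n} ∧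
        dist o (φ w o) < T}) ≤ 2 * c * Real.log 5 / n := fun n hn => by
    filter_upwards [eventually_ge_atTop c] with T hT
    have hT0 : 0 < T := hc0.trans_le hT
    rw [one_div_mul_eq_div, div_le_iff₀ hT0]
    refine (log_ncard_closure_pow_le hc0 h (by omega) hT0.le).trans ?_
    calc c * (T + c) / n * Real.log 5 ≤ c * (T + T) / n * Real.log 5 := by gcongr
      _ = 2 * c * Real.log 5 / n * T := by ring
  have hle : ∀ n : ℕ, 1 ≤ n → δ n ≤ 2 * c * Real.log 5 / n := fun n hn =>
    limsup_le_of_le (IsBoundedUnder.isCoboundedUnder_le ⟨0, hnonneg n⟩) (hbound n hn)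
  have hge : ∀ n : ℕ, 1 ≤ n → 0 ≤ δ n := fun n hn =>
    le_limsup_of_frequently_le (hnonneg n).frequently ⟨_, hbound n hn⟩
  refine ⟨hle, squeeze_zero' ?_ ?_ (tendsto_const_div_atTop_nhds_zero_nat (2 * c * Real.log 5))⟩
  · filter_upwards [eventually_ge_atTop 1] with n hn using hge n hn
  · filter_upwards [eventually_ge_atTop 1] with n hn using hle n hn
end
end
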